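/- Let n ≥ 1 and let π ∈ S_n. If π contains the pattern 321 or contains the pattern 3412, then the fiber of the MVP outcome map over π satisfies the strict inequality |O_n^{-1}(π)| < ∏_{j=1}^{n} |Ω_j(π)|. -/

import Mathlib

open Finset

namespace MVPPark

/-- One step of the MVP parking process: car `c`, preferring spot `p`, arrives at the
state `state` (recording, for each spot, the car parked there, if any).  Car `c` always
parks in spot `p`; if spot `p` was occupied by an (earlier) car `j`, then `j` is bumped
and parks in the first unoccupied spot strictly beyond `p`, if such a spot exists
(otherwise `j` drives off unparked). -/
def mvpStep {n : ℕ} (state : Fin n → Option (Fin n)) (c p : Fin n) :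
    Fin n → Option (Fin n) :=
  match state p with
  | none => Function.update state p (some c)
  | some j =>
    match (List.finRange n).find? (fun k => decide (p < k) && (state k).isNone) with
    | none => Function.update state p (some c)
    | some k => Function.update (Function.update state p (some c)) k (some j)

/-- The final state of the MVP parking process with preference list `α`:
cars `0, 1, …, n-1` enter in order, car `i` preferring spot `α i`. -/
def mvpRun {n : ℕ} (α : Fin n → Fin n) : Fin n → Option (Fin n) :=
  (List.finRange n).foldl (fun st c => mvpStep st c (α c)) (fun _ => none)

/-- `α` is an MVP parking function: under the MVP rule, all `n` cars end up parked. -/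
def IsMVP {n : ℕ} (α : Fin n → Fin n) : Prop :=
  ∀ c : Fin n, ∃ j : Fin n, mvpRun α j = some c

/-- The outcome of the MVP parking process on `α` is the permutation `π`:
for each `j`, spot `j` ends up occupied by car `π j`. -/
def MvpOutcome {n : ℕ} (α : Fin n → Fin n) (π : Equiv.Perm (Fin n)) : Prop :=
  ∀ j : Fin n, mvpRun α j = some (π j)

end MVPPark

namespace MVPPark

/-- `C_j(π)`: the set of cars arriving after car `π j` that park to the left of
spot `j`, together with car `π j` itself. -/
def Cset {n : ℕ} (π : Equiv.Perm (Fin n)) (j : Fin n) : Finset (Fin n) :=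
  ((Finset.univ.filter (fun k => k < j)).image π ∩
      Finset.univ.filter (fun c => π j < c)) ∪ {π j}

/-- `Ω_j(π)`: the set of spots on or to the left of spot `j` occupied (in the outcome
`π`) by a car of `C_j(π)`. -/
def Omega {n : ℕ} (π : Equiv.Perm (Fin n)) (j : Fin n) : Finset (Fin n) :=
  Finset.univ.filter (fun k => k ≤ j ∧ π k ∈ Cset π j)

end MVPPark

namespace MVPPark

/-- `π` contains the pattern `321`. -/
def Contains321 {n : ℕ} (π : Equiv.Perm (Fin n)) : Prop :=
  ∃ x y z : Fin n, x < y ∧ y < z ∧ π z < π y ∧ π y < π x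

/-- `π` contains the pattern `3412`. -/
def Contains3412 {n : ℕ} (π : Equiv.Perm (Fin n)) : Prop :=
  ∃ w x y z : Fin n, w < x ∧ x < y ∧ y < z ∧ π y < π z ∧ π z < π w ∧ π w < π x

end MVPPark

namespace MVPPark

variable {n : ℕ}

/-- Either arriving at `p` just overwrites spot `p`, which happens when nobody is bumped or the
bumped car finds no free spot, or the bumped car moves to the first free spot beyond `p`. -/
lemma mvpStep_cases (s : Fin n → Option (Fin n)) (c p : Fin n) :
    (mvpStep s c p = Function.update s p (some c) ∧
      (s p = none ∨ ∀ k, p < k → s k ≠ none)) ∨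
    ∃ j k, s p = some j ∧ p < k ∧ s k = none ∧ (∀ l, p < l → l < k → s l ≠ none) ∧
      mvpStep s c p = Function.update (Function.update s p (some c)) k (some j) := by
  unfold mvpStep
  cases hp : s p with
  | none => simp
  | some j =>
    cases hk : (List.finRange n).find? (fun k => decide (p < k) && (s k).isNone) with
    | none =>
      rw [List.find?_eq_none] at hk
      left
      refine ⟨rfl, Or.inr fun k hpk hn => ?_⟩
      have := hk k (List.mem_finRange k)
      simp [hpk, hn] at this
    | some k =>
      rw [List.find?_eq_some_iff_getElem] at hk
      obtain ⟨h, i, hi, hik, hlt⟩ := hk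
      right
      simp only [Bool.and_eq_true, decide_eq_true_eq, Option.isNone_iff_eq_none] at h
      refine ⟨j, k, rfl, h.1, h.2, fun l hpl hlk hl => ?_, rfl⟩
      have hki : i = k.val := by
        rw [← hik]; simp
      have := hlt l.val (by omega)
      simp [hpl, hl] at this

lemma mvpStep_self (s : Fin n → Option (Fin n)) (c p : Fin n) :
    mvpStep s c p p = some c := by
  rcases mvpStep_cases s c p with ⟨h, -⟩ | ⟨j, k, -, hk, -, -, h⟩
  · simp [h]
  · simp [h, Function.update_of_ne hk.ne]

lemma mvpStep_of_occupied {s : Fin n → Option (Fin n)} {c p q d : Fin n} (hq : q ≠ p)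
    (hs : s q = some d) : mvpStep s c p q = some d := by
  rcases mvpStep_cases s c p with ⟨h, -⟩ | ⟨j, k, -, -, hn, -, h⟩
  · simp [h, hq, hs]
  · have : q ≠ k := by rintro rfl; simp [hs] at hn
    simp [h, hq, this, hs]

lemma mvpStep_bump {s : Fin n → Option (Fin n)} {c p y u : Fin n} (hp : s p = some u)
    (hy : p < y) (hs : s y = none) :
    ∃ k, p < k ∧ k ≤ y ∧ s k = none ∧ mvpStep s c p k = some u := by
  rcases mvpStep_cases s c p with ⟨-, h | h⟩ | ⟨j, k, hj, hk, hn, hf, h⟩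
  · simp [hp] at h
  · exact absurd hs (h y hy)
  · refine ⟨k, hk, not_lt.1 fun hyk => hf y hy hyk hs, hn, ?_⟩
    rw [h, Function.update_self, ← hj, hp]

/-- The state of the street after the first `t` cars have entered. -/
def stateAt (α : Fin n → Fin n) (t : ℕ) : Fin n → Option (Fin n) :=
  ((List.finRange n).take t).foldl (fun st c => mvpStep st c (α c)) (fun _ => none)

lemma stateAt_zero (α : Fin n → Fin n) : stateAt α 0 = fun _ => none := by
  simp [stateAt]

lemma stateAt_last (α : Fin n → Fin n) : stateAt α n = mvpRun α := by
  rw [stateAt, List.take_of_length_le (by simp), mvpRun]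

lemma stateAt_succ (α : Fin n → Fin n) (c : Fin n) :
    stateAt α (c + 1) = mvpStep (stateAt α c) c (α c) := by
  have hc : c.val < (List.finRange n).length := by simp
  rw [stateAt, List.take_succ_eq_append_getElem hc]
  simp [stateAt, List.foldl_append]

/-- The cars on the street have already entered, no car is in two spots, and no car is to the
left of its preferred spot. -/
lemma stateAt_invariant (α : Fin n → Fin n) (t : ℕ) (ht : t ≤ n) :
    (∀ q d, stateAt α t q = some d → d.val < t ∧ α d ≤ q) ∧
    (∀ q q' d, stateAt α t q = some d → stateAt α t q' = some d → q = q') := by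
  induction t with
  | zero => simp [stateAt_zero]
  | succ t ih =>
    obtain ⟨h1, h2⟩ := ih (by omega)
    have hs := stateAt_succ α ⟨t, ht⟩
    simp only at hs
    rw [hs]
    rcases mvpStep_cases (stateAt α t) ⟨t, ht⟩ (α ⟨t, ht⟩) with ⟨h, -⟩ | ⟨j, k, hj, hk, hn, -, h⟩
    · rw [h]
      simp only [Function.update_apply]
      constructor
      · grind
      · grind
    · rw [h]
      simp only [Function.update_apply]
      constructor
      · grind
      · grind

lemma stateAt_persist {α : Fin n → Fin n} {t s : ℕ} (hts : t ≤ s) (hs : s ≤ n) {q d : Fin n}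
    (hq : stateAt α t q = some d) (hα : ∀ c : Fin n, t ≤ c → c.val < s → α c ≠ q) :
    stateAt α s q = some d := by
  induction s, hts using Nat.le_induction with
  | base => exact hq
  | succ s hts ih =>
    have h := stateAt_succ α ⟨s, hs⟩
    simp only at h
    rw [h]
    exact mvpStep_of_occupied (hα ⟨s, hs⟩ hts (by simp)).symm
      (ih (by omega) fun c h1 h2 => hα c h1 (by omega))

lemma stateAt_parked {α : Fin n → Fin n} (c : Fin n) {s : ℕ} (hcs : c.val < s) (hs : s ≤ n)
    (hα : ∀ d : Fin n, c < d → d.val < s → α d ≠ α c) : stateAt α s (α c) = some c :=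
  stateAt_persist (t := c + 1) hcs hs (by rw [stateAt_succ, mvpStep_self])
    fun d h1 h2 => hα d (by omega) h2

/-- Once a spot has been preferred, its occupant is at least as late as the car preferring it. -/
lemma exists_stateAt_preferred (α : Fin n → Fin n) (c : Fin n) {s : ℕ} (hcs : c.val + 1 ≤ s)
    (hs : s ≤ n) : ∃ d, c ≤ d ∧ stateAt α s (α c) = some d := by
  induction s, hcs using Nat.le_induction with
  | base => exact ⟨c, le_rfl, by rw [stateAt_succ, mvpStep_self]⟩
  | succ s hcs ih =>
    have h := stateAt_succ α ⟨s, hs⟩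
    simp only at h
    rw [h]
    by_cases hp : α ⟨s, hs⟩ = α c
    · exact ⟨⟨s, hs⟩, by rw [Fin.le_def]; simp only; omega, by rw [← hp, mvpStep_self]⟩
    · obtain ⟨d, hd, hd'⟩ := ih (by omega)
      exact ⟨d, hd, mvpStep_of_occupied (Ne.symm hp) hd'⟩

lemma mem_Omega {π : Equiv.Perm (Fin n)} {j k : Fin n} :
    k ∈ Omega π j ↔ k ≤ j ∧ π j ≤ π k := by
  simp only [Omega, Cset, mem_filter, mem_univ, true_and, mem_union, mem_inter, mem_image,
    mem_singleton, EmbeddingLike.apply_eq_iff_eq, exists_eq_right]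
  constructor
  · rintro ⟨h, ⟨-, h'⟩ | rfl⟩
    · exact ⟨h, h'.le⟩
    · exact ⟨h, le_rfl⟩
  · rintro ⟨h, h'⟩
    rcases h.eq_or_lt with rfl | hlt
    · exact ⟨h, Or.inr rfl⟩
    · exact ⟨h, Or.inl ⟨hlt, h'.lt_of_ne (by simpa using hlt.ne')⟩⟩

namespace MvpOutcome

variable {α : Fin n → Fin n} {π : Equiv.Perm (Fin n)}

lemma stateAt_last (h : MvpOutcome α π) (j : Fin n) : stateAt α n j = some (π j) := by
  rw [MVPPark.stateAt_last]; exact h j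

lemma mem_Omega (h : MvpOutcome α π) (j : Fin n) : α (π j) ∈ Omega π j := by
  rw [MVPPark.mem_Omega]
  refine ⟨((stateAt_invariant α n le_rfl).1 j _ (h.stateAt_last j)).2, ?_⟩
  obtain ⟨d, hd, hd'⟩ := exists_stateAt_preferred α (π j) (s := n) (π j).isLt le_rfl
  rw [h.stateAt_last, Option.some_inj] at hd'
  rwa [hd']

lemma apply_eq_of_stateAt (h : MvpOutcome α π) {t : ℕ} (ht : t ≤ n) {q d : Fin n}
    (hq : stateAt α t q = some d) (hα : ∀ c : Fin n, t ≤ c → α c ≠ q) : π q = d := by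
  have := stateAt_persist ht le_rfl hq fun c h1 _ => hα c h1
  rwa [h.stateAt_last, Option.some_inj] at this

/-- If `v` bumps `u` while `y` is free, then `u` lands on some free spot weakly left of `y`, and
stays there unless that spot is preferred by a later car. -/
lemma exists_bumped_spot (h : MvpOutcome α π) {u v y : Fin n} (huv : u < v) (hp : α u = α v)
    (hbetween : ∀ d, u < d → d < v → α d ≠ α v) (hy : α v < y) (hfree : stateAt α v y = none) :
    ∃ k, α v < k ∧ k ≤ y ∧ stateAt α v k = none ∧ ((∀ c, v < c → α c ≠ k) → π k = u) := by
  have hu : stateAt α v (α v) = some u :=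
    hp ▸ stateAt_parked u huv v.isLt.le fun d h1 h2 => hp ▸ hbetween d h1 h2
  obtain ⟨k, h1, h2, h3, h4⟩ := mvpStep_bump (c := v) hu hy hfree
  rw [← stateAt_succ] at h4
  exact ⟨k, h1, h2, h3, fun hα => h.apply_eq_of_stateAt v.isLt h4 fun c hc => hα c hc⟩

end MvpOutcome

lemma card_fiber_lt (π : Equiv.Perm (Fin n)) (β : Fin n → Fin n) (hβ : ∀ j, β j ∈ Omega π j)
    (hnot : ¬ MvpOutcome (β ∘ π.symm) π) :
    Nat.card {α : Fin n → Fin n // MvpOutcome α π} < ∏ j : Fin n, (Omega π j).card := by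
  classical
  rw [Nat.card_eq_fintype_card, Fintype.card_subtype, ← Fintype.card_piFinset,
    ← card_image_of_injective _ π.surjective.injective_comp_right]
  apply card_lt_card
  rw [ssubset_iff_of_subset]
  · refine ⟨β, Fintype.mem_piFinset.2 hβ, fun hmem => ?_⟩
    obtain ⟨α, hα, rfl⟩ := mem_image.1 hmem
    apply hnot
    simpa [Function.comp_assoc] using hα
  · intro γ hγ
    obtain ⟨α, hα, rfl⟩ := mem_image.1 hγ
    exact Fintype.mem_piFinset.2 (mem_filter.1 hα).2.mem_Omega

lemma card_fiber_lt_of_contains321 {π : Equiv.Perm (Fin n)} (h : Contains321 π) :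
    Nat.card {α : Fin n → Fin n // MvpOutcome α π} < ∏ j : Fin n, (Omega π j).card := by
  obtain ⟨x₀, y, z, hxy₀, hyz, hzy, hyx₀⟩ := h
  obtain ⟨x, ⟨hxy, hyx⟩, hmax⟩ := WellFounded.has_min
    (wellFounded_gt (α := Fin n)) {x | x < y ∧ π y < π x} ⟨x₀, hxy₀, hyx₀⟩
  have hmax : ∀ k, x < k → k < y → π k < π y := fun k h1 h2 =>
    (not_lt.1 fun h3 => hmax k ⟨h2, h3⟩ h1).lt_of_ne (by simpa using h2.ne)
  let β : Fin n → Fin n := fun k => if k = y ∨ k = z then x else k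
  refine card_fiber_lt π β (fun j => ?_) fun ho => ?_
  · rw [mem_Omega]; grind
  set α := β ∘ π.symm
  have hα : ∀ j, α (π j) = β j := by simp [α]
  have hpref : ∀ c q, α c = q → ∃ j, π j = c ∧ β j = q := fun c q hc =>
    ⟨π.symm c, by simp, hc⟩
  have hαy : α (π y) = x := by rw [hα]; grind
  have hαz : α (π z) = x := by rw [hα]; grind
  have hy : ∀ c, α c ≠ y := fun c hc => by
    obtain ⟨j, -, hj⟩ := hpref c y hc
    grind
  have hfree : stateAt α (π y) y = none := by
    by_contra hne
    obtain ⟨d, hd⟩ := Option.ne_none_iff_exists'.1 hne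
    have h1 := ho.apply_eq_of_stateAt (π y).isLt.le hd fun c _ => hy c
    have h2 := ((stateAt_invariant α _ (π y).isLt.le).1 _ _ hd).1
    grind
  obtain ⟨k, hxk, hky, -, hk⟩ := ho.exists_bumped_spot hzy (hαz.trans hαy.symm)
    (fun d h1 h2 h3 => by
      obtain ⟨j, rfl, hj⟩ := hpref d _ h3
      grind) (hαy ▸ hxy) hfree
  have : π k = π z := hk fun c hc hck => by
    obtain ⟨j, rfl, hj⟩ := hpref c _ hck
    have := hmax k
    grind
  grind [π.injective this]

lemma card_fiber_lt_of_contains3412 {π : Equiv.Perm (Fin n)} (h : Contains3412 π)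
    (havoid : ¬ Contains321 π) :
    Nat.card {α : Fin n → Fin n // MvpOutcome α π} < ∏ j : Fin n, (Omega π j).card := by
  obtain ⟨w₀, x₀, y, z, hwx₀, hxy₀, hyz, hπyz, hzw₀, hπwx₀⟩ := h
  obtain ⟨w, ⟨x, hwx, hxy, hzw, hπwx⟩, hmax⟩ := WellFounded.has_min
    (wellFounded_gt (α := Fin n)) {w | ∃ x, w < x ∧ x < y ∧ π z < π w ∧ π w < π x}
    ⟨w₀, x₀, hwx₀, hxy₀, hzw₀, hπwx₀⟩
  have hmax : ∀ k, w < k → k < y → k ≠ x → π k < π w := by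
    intro k hwk hky hkx
    by_contra! hlt
    have hne : π k ≠ π x := fun h => hkx (π.injective h)
    have hne' : π k ≠ π w := fun h => hwk.ne' (π.injective h)
    rcases lt_or_gt_of_ne hkx with hkx | hkx <;> rcases lt_or_gt_of_ne hne with hlt' | hlt'
    · exact hmax k ⟨x, hkx, hxy, by order, hlt'⟩ hwk
    · exact havoid ⟨k, x, z, hkx, by order, by order, hlt'⟩
    · exact havoid ⟨x, k, y, hkx, hky, by order, hlt'⟩
    · exact hmax x ⟨k, hkx, hky, by order, hlt'⟩ hwx
  let β : Fin n → Fin n := fun k => if k = y then x else if k = z then w else k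
  refine card_fiber_lt π β (fun j => ?_) fun ho => ?_
  · rw [mem_Omega]; grind
  set α := β ∘ π.symm
  have hα : ∀ j, α (π j) = β j := by simp [α]
  have hpref : ∀ c q, α c = q → ∃ j, π j = c ∧ β j = q := fun c q hc =>
    ⟨π.symm c, by simp, hc⟩
  have hαy : α (π y) = x := by rw [hα]; grind
  have hαz : α (π z) = w := by rw [hα]; grind
  have hαw : α (π w) = w := by rw [hα]; grind
  have hy : ∀ c, α c ≠ y := fun c hc => by
    obtain ⟨j, -, hj⟩ := hpref c y hc
    grind
  have hx : stateAt α (π w) x = some (π y) :=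
    hαy ▸ stateAt_parked (π y) (hπyz.trans hzw) (π w).isLt.le fun d h1 h2 h3 => by
      obtain ⟨j, rfl, hj⟩ := hpref d _ h3
      grind
  have hfree : stateAt α (π w) y = none := by
    by_contra hne
    obtain ⟨d, hd⟩ := Option.ne_none_iff_exists'.1 hne
    have h1 := ho.apply_eq_of_stateAt (π w).isLt.le hd fun c _ => hy c
    exact hxy.ne ((stateAt_invariant α _ (π w).isLt.le).2 _ _ _ hx (h1 ▸ hd))
  obtain ⟨k, hwk, hky, hkn, hk⟩ := ho.exists_bumped_spot hzw (hαz.trans hαw.symm)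
    (fun d h1 h2 h3 => by
      obtain ⟨j, rfl, hj⟩ := hpref d _ h3
      grind) (by order) hfree
  have hkx : k ≠ x := by rintro rfl; simp [hx] at hkn
  have : π k = π z := hk fun c hc hck => by
    obtain ⟨j, rfl, hj⟩ := hpref c _ hck
    have := hmax k
    grind
  grind [π.injective this]

end MVPPark

open MVPPark in
/-- If `π` contains the pattern `321` or the pattern `3412`, then the fiber of the MVP
outcome map over `π` is strictly smaller than `∏_j |Ω_j(π)|`. -/
theorem fiber_lt_of_contains (n : ℕ) (hn : 1 ≤ n) (π : Equiv.Perm (Fin n))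
    (h : Contains321 π ∨ Contains3412 π) :
    Nat.card {α : Fin n → Fin n // MvpOutcome α π} < ∏ j : Fin n, (Omega π j).card := by
  by_cases h' : Contains321 π
  · exact card_fiber_lt_of_contains321 h'
  · exact card_fiber_lt_of_contains3412 (h.resolve_left h') h'
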